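/- Let N, M be integers with 0 ≤ M < N, set α = M/N, and let λ > 0. Let (G₁ᵢ)_{i=1}^N and (G₂ᵢ)_{i=1}^N be 2N independent random variables, each distributed according to the gamma distribution with shape 1/(N−M) and scale λ. Then E|∑_{i=1}^N (G₁ᵢ − G₂ᵢ)| = 2λ / B(1/2, 1/(1−α)), where B(x, y) = Γ(x)Γ(y)/Γ(x+y) is the beta function. In particular, for the perturbed aggregate X̂_t whose noise is the above sum, the mean absolute percentage error satisfies μ(t) = E|X_t − X̂_t| / (X_t + 1) ≤ (2 / B(1/2, 1/(1−α))) · λ / (X_t + 1). -/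

import Mathlib

open MeasureTheory ProbabilityTheory Real

lemma measurable_gammaPDF (a r : ℝ) : Measurable (gammaPDF a r) :=
  (measurable_gammaPDFReal a r).ennreal_ofReal

/-- Integrals against a gamma measure, written with the density on `(0, ∞)`. -/
lemma integral_gammaMeasure {a r : ℝ} (ha : 0 < a) (hr : 0 < r) (f : ℝ → ℝ) :
    ∫ x, f x ∂(gammaMeasure a r) =
      ∫ x in Set.Ioi 0, r ^ a / Gamma a * x ^ (a - 1) * exp (-(r * x)) * f x := by
  rw [gammaMeasure, integral_withDensity_eq_integral_toReal_smul
      (measurable_gammaPDF a r) (ae_of_all _ fun _ => ENNReal.ofReal_lt_top),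
    ← integral_Ici_eq_integral_Ioi, ← integral_indicator measurableSet_Ici]
  refine integral_congr_ae (ae_of_all _ fun x => ?_)
  simp only [gammaPDF, ENNReal.toReal_ofReal (gammaPDFReal_nonneg ha hr x), smul_eq_mul]
  by_cases hx : 0 ≤ x <;> simp [gammaPDFReal, hx]

lemma integrable_gammaMeasure_iff {a r : ℝ} (ha : 0 < a) (hr : 0 < r) (f : ℝ → ℝ) :
    Integrable f (gammaMeasure a r) ↔
      IntegrableOn (fun x => r ^ a / Gamma a * x ^ (a - 1) * exp (-(r * x)) * f x)
        (Set.Ioi 0) := by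
  rw [gammaMeasure, integrable_withDensity_iff_integrable_smul'
      (measurable_gammaPDF a r) (ae_of_all _ fun _ => ENNReal.ofReal_lt_top),
    ← integrableOn_Ici_iff_integrableOn_Ioi, ← integrable_indicator_iff measurableSet_Ici]
  refine integrable_congr (ae_of_all _ fun x => ?_)
  simp only [gammaPDF, ENNReal.toReal_ofReal (gammaPDFReal_nonneg ha hr x), smul_eq_mul]
  by_cases hx : 0 ≤ x <;> simp [gammaPDFReal, hx]

lemma mgf_gammaMeasure_of_lt {a r t : ℝ} (ha : 0 < a) (hr : 0 < r) (ht : t < r) :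
    mgf id (gammaMeasure a r) t = (r / (r - t)) ^ a := by
  have hrt : 0 < r - t := sub_pos.mpr ht
  rw [mgf, integral_gammaMeasure ha hr]
  have h : ∀ x : ℝ, r ^ a / Gamma a * x ^ (a - 1) * exp (-(r * x)) * exp (t * id x) =
      r ^ a / Gamma a * (x ^ (a - 1) * exp (-((r - t) * x))) := fun x => by
    rw [mul_assoc, ← exp_add, id, mul_assoc]
    ring_nf
  simp_rw [h]
  rw [integral_const_mul, integral_rpow_mul_exp_neg_mul_Ioi ha hrt,
    div_rpow hr.le hrt.le, div_rpow zero_le_one hrt.le, one_rpow]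
  have := (Gamma_pos_of_pos ha).ne'
  field_simp

lemma mgf_gammaMeasure_of_le {a r t : ℝ} (ha : 0 < a) (hr : 0 < r) (ht : r ≤ t) :
    mgf id (gammaMeasure a r) t = 0 := by
  refine integral_undef fun h => ?_
  rw [integrable_gammaMeasure_iff ha hr] at h
  have hc : 0 < r ^ a / Gamma a := div_pos (rpow_pos_of_pos hr a) (Gamma_pos_of_pos ha)
  refine not_integrableOn_Ioi_rpow (a - 1) ((h.const_mul (r ^ a / Gamma a)⁻¹).mono'
    (by fun_prop) ((ae_restrict_iff' measurableSet_Ioi).mpr (ae_of_all _ fun x hx => ?_)))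
  have hx : 0 < x := hx
  have hxa : 0 < x ^ (a - 1) := rpow_pos_of_pos hx _
  rw [norm_of_nonneg hxa.le]
  have h1 : 1 ≤ exp (-(r * x)) * exp (t * id x) := by
    rw [← exp_add, id]
    exact one_le_exp (by nlinarith)
  calc x ^ (a - 1) ≤ x ^ (a - 1) * (exp (-(r * x)) * exp (t * id x)) :=
        le_mul_of_one_le_right hxa.le h1
    _ = _ := by field_simp

/-- A measure on `ℝ` is determined by its moment generating function when this is finite in a
neighbourhood of `0`. -/
lemma ext_of_mgf_eq_of_zero_mem_interior {μ ν : Measure ℝ} [IsProbabilityMeasure μ]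
    [IsFiniteMeasure ν] (h0 : 0 ∈ interior (integrableExpSet id μ))
    (h : mgf id μ = mgf id ν) : μ = ν := by
  refine Measure.ext_of_charFun (funext fun t => ?_)
  rw [← complexMGF_id_mul_I, ← complexMGF_id_mul_I]
  exact eqOn_complexMGF_of_mgf h (by simpa using h0)

lemma zero_mem_interior_integrableExpSet_gammaMeasure {a r : ℝ} (ha : 0 < a) (hr : 0 < r) :
    0 ∈ interior (integrableExpSet id (gammaMeasure a r)) := by
  refine mem_interior.mpr ⟨Set.Iio r, fun t ht => ?_, isOpen_Iio, hr⟩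
  by_contra hn
  have h := mgf_gammaMeasure_of_lt ha hr ht
  rw [mgf, integral_undef hn] at h
  exact (rpow_pos_of_pos (div_pos hr (sub_pos.mpr ht)) a).ne h

/-- The sum of independent gamma variables of common rate and shape is gamma distributed. -/
lemma map_sum_pi_gammaMeasure {ι : Type*} [Fintype ι] [Nonempty ι] {a r : ℝ} (ha : 0 < a)
    (hr : 0 < r) :
    (Measure.pi fun _ : ι => gammaMeasure a r).map (fun x => ∑ i, x i) =
      gammaMeasure (Fintype.card ι * a) r := by
  have := isProbabilityMeasure_gammaMeasure ha hr
  have hna : 0 < Fintype.card ι * a := mul_pos (by exact_mod_cast Fintype.card_pos) ha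
  have := isProbabilityMeasure_gammaMeasure hna hr
  have hm : Measurable fun x : ι → ℝ => ∑ i, x i := by fun_prop
  have := Measure.isProbabilityMeasure_map
    (μ := Measure.pi fun _ : ι => gammaMeasure a r) hm.aemeasurable
  refine (ext_of_mgf_eq_of_zero_mem_interior
    (zero_mem_interior_integrableExpSet_gammaMeasure hna hr) (funext fun t => ?_)).symm
  have hs : mgf id ((Measure.pi fun _ : ι => gammaMeasure a r).map (fun x => ∑ i, x i)) t =
      mgf id (gammaMeasure a r) t ^ Fintype.card ι := by
    rw [mgf, integral_map hm.aemeasurable (by fun_prop)]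
    simp only [id, Finset.mul_sum, exp_sum, mgf]
    exact integral_fintype_prod_eq_pow fun x => exp (t * x)
  rw [hs]
  rcases lt_or_ge t r with ht | ht
  · rw [mgf_gammaMeasure_of_lt hna hr ht, mgf_gammaMeasure_of_lt ha hr ht, mul_comm,
      rpow_mul (div_pos hr (sub_pos.mpr ht)).le, rpow_natCast]
  · rw [mgf_gammaMeasure_of_le hna hr ht, mgf_gammaMeasure_of_le ha hr ht,
      zero_pow Fintype.card_ne_zero]

lemma integrable_id_gammaMeasure {a r : ℝ} (ha : 0 < a) (hr : 0 < r) :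
    Integrable (fun x => x) (gammaMeasure a r) :=
  have := isProbabilityMeasure_gammaMeasure ha hr
  integrable_of_mem_interior_integrableExpSet
    (zero_mem_interior_integrableExpSet_gammaMeasure ha hr)

lemma integral_Ioi_gammaPDF_mul_sub {a r y : ℝ} (ha : 0 < a) (hr : 0 < r) (hy : 0 ≤ y) :
    ∫ x in Set.Ioi y, r ^ a / Gamma a * x ^ (a - 1) * exp (-(r * x)) * (r * x - a) =
      r ^ a / Gamma a * (y ^ a * exp (-(r * y))) := by
  have := isProbabilityMeasure_gammaMeasure ha hr
  have hint := (integrable_gammaMeasure_iff ha hr (fun x => r * x - a)).mp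
    (((integrable_id_gammaMeasure ha hr).const_mul r).sub (integrable_const a))
  have h := integral_Ioi_of_hasDerivAt_of_tendsto (a := y) (m := 0)
    (f := fun x => -(r ^ a / Gamma a * (x ^ a * exp (-(r * x)))))
    (f' := fun x => r ^ a / Gamma a * x ^ (a - 1) * exp (-(r * x)) * (r * x - a))
    (Continuous.continuousWithinAt (by
      have := continuous_rpow_const (q := a) ha.le
      fun_prop))
    (fun x hx => ?_) (hint.mono_set (Set.Ioi_subset_Ioi hy)) ?_
  · simpa using h
  · have hx : 0 < x := hy.trans_lt hx
    have h1 := hasDerivAt_rpow_const (x := x) (p := a) (Or.inl hx.ne')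
    have h2 : HasDerivAt (fun x => exp (-(r * x))) (exp (-(r * x)) * -(r * 1)) x :=
      ((hasDerivAt_id x).const_mul r).neg.exp
    refine ((h1.mul h2).const_mul (r ^ a / Gamma a)).neg.congr_deriv ?_
    have h3 : x ^ a = x ^ (a - 1) * x := by
      rw [← rpow_add_one hx.ne', sub_add_cancel]
    rw [h3]
    ring
  · have := ((tendsto_rpow_mul_exp_neg_mul_atTop_nhds_zero a r hr).const_mul
      (r ^ a / Gamma a)).neg
    simpa [neg_mul] using this

/-- Stein's identity for the gamma distribution, applied to a shifted sign function. -/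
lemma integral_sub_mul_sign_gammaMeasure {a r y : ℝ} (ha : 0 < a) (hr : 0 < r) (hy : 0 ≤ y) :
    ∫ x, (r * x - a) * sign (x - y) ∂(gammaMeasure a r) =
      2 * (r ^ a / Gamma a * (y ^ a * exp (-(r * y)))) := by
  have := isProbabilityMeasure_gammaMeasure ha hr
  set g : ℝ → ℝ := fun x => r ^ a / Gamma a * x ^ (a - 1) * exp (-(r * x)) * (r * x - a)
  have hint : IntegrableOn g (Set.Ioi 0) := (integrable_gammaMeasure_iff ha hr _).mp
    (((integrable_id_gammaMeasure ha hr).const_mul r).sub (integrable_const a))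
  have h0 : ∫ x in Set.Ioi 0, g x = 0 := by
    simpa [ha.ne'] using integral_Ioi_gammaPDF_mul_sub ha hr le_rfl
  have hy' := integral_Ioi_gammaPDF_mul_sub ha hr hy
  have hsplit : Set.Ioi 0 = Set.Ioc 0 y ∪ Set.Ioi y := (Set.Ioc_union_Ioi_eq_Ioi hy).symm
  have hd : Disjoint (Set.Ioc 0 y) (Set.Ioi y) :=
    Set.disjoint_left.mpr fun x hx hx' => not_lt.mpr hx.2 hx'
  have hlow : Set.EqOn (fun x => g x * sign (x - y)) (fun x => - g x) (Set.Ioo 0 y) :=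
    fun x hx => by simp [sign_of_neg (sub_neg.mpr hx.2)]
  have hhigh : Set.EqOn (fun x => g x * sign (x - y)) g (Set.Ioi y) :=
    fun x hx => by simp [sign_of_pos (sub_pos.mpr hx)]
  have hlowint : IntegrableOn g (Set.Ioc 0 y) := hint.mono_set (by simp [hsplit])
  have hhighint : IntegrableOn g (Set.Ioi y) := hint.mono_set (by simp [hsplit])
  rw [integral_gammaMeasure ha hr]
  simp_rw [← mul_assoc]
  change ∫ x in Set.Ioi 0, g x * sign (x - y) = _
  rw [hsplit, setIntegral_union hd measurableSet_Ioi] at h0 ⊢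
  · rw [integral_Ioc_eq_integral_Ioo, setIntegral_congr_fun measurableSet_Ioo hlow,
      setIntegral_congr_fun measurableSet_Ioi hhigh, integral_neg,
      ← integral_Ioc_eq_integral_Ioo]
    linarith
  · exact Iff.mpr integrableOn_Ioc_iff_integrableOn_Ioo
      ((integrableOn_congr_fun hlow measurableSet_Ioo).mpr
        (hlowint.mono_set Set.Ioo_subset_Ioc_self).neg)
  · exact (integrableOn_congr_fun hhigh measurableSet_Ioi).mpr hhighint
  · exact hlowint
  · exact hhighint

lemma measurable_real_sign : Measurable Real.sign :=
  Measurable.ite measurableSet_Iio measurable_const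
    (Measurable.ite measurableSet_Ioi measurable_const measurable_const)

/-- Gini mean difference of the gamma distribution. -/
lemma integral_abs_sub_prod_gammaMeasure {a r : ℝ} (ha : 0 < a) (hr : 0 < r) :
    ∫ p : ℝ × ℝ, |p.1 - p.2| ∂((gammaMeasure a r).prod (gammaMeasure a r)) =
      2 / r / (Gamma (1 / 2) * Gamma a / Gamma (1 / 2 + a)) := by
  have := isProbabilityMeasure_gammaMeasure ha hr
  set γ := gammaMeasure a r with hγ
  let f : ℝ × ℝ → ℝ := fun p => (r * p.1 - a) * sign (p.1 - p.2)
  have hf : Integrable f (γ.prod γ) := by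
    refine Integrable.mul_bdd (c := 1) ?_ ?_ (ae_of_all _ fun p => ?_)
    · exact (((integrable_id_gammaMeasure ha hr).const_mul r).sub
        (integrable_const a)).comp_fst γ
    · exact (measurable_real_sign.comp
        (measurable_fst.sub measurable_snd)).aestronglyMeasurable
    · rcases sign_apply_eq (p.1 - p.2) with h | h | h <;> simp [h]
  have habs : ∀ p : ℝ × ℝ, |p.1 - p.2| = r⁻¹ * (f p + f p.swap) := fun p => by
    have h1 : sign (p.2 - p.1) = - sign (p.1 - p.2) := by rw [← sign_neg, neg_sub]
    have h2 : sign (p.1 - p.2) * (p.1 - p.2) = |p.1 - p.2| := by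
      rcases lt_trichotomy (p.1 - p.2) 0 with h | h | h
      · rw [sign_of_neg h, abs_of_neg h]; ring
      · simp [h]
      · rw [sign_of_pos h, abs_of_pos h]; ring
    simp only [f, Prod.fst_swap, Prod.snd_swap, h1, ← h2]
    field_simp
    ring
  have hE : ∫ p, f p ∂(γ.prod γ) =
      2 * (r ^ a / Gamma a) ^ 2 * ((1 / (2 * r)) ^ (2 * a) * Gamma (2 * a)) := by
    rw [integral_prod_symm _ hf, hγ, integral_gammaMeasure ha hr,
      ← integral_rpow_mul_exp_neg_mul_Ioi (by positivity) (by positivity), ← integral_const_mul]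
    refine setIntegral_congr_fun measurableSet_Ioi fun y (hy : 0 < y) => ?_
    have h1 : y ^ (2 * a - 1) = y ^ (a - 1) * y ^ a := by
      rw [← rpow_add hy]; ring_nf
    have h2 : exp (-(2 * r * y)) = exp (-(r * y)) * exp (-(r * y)) := by
      rw [← exp_add]; ring_nf
    simp only [f, integral_sub_mul_sign_gammaMeasure ha hr hy.le, h1, h2]
    ring
  simp_rw [habs]
  have hf' : Integrable (fun p => f (Prod.swap p)) (γ.prod γ) := hf.swap
  rw [integral_const_mul, integral_add hf hf', integral_prod_swap, hE]
  have hdup := Gamma_mul_Gamma_add_half a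
  have hG := Gamma_pos_of_pos ha
  have hpow : (2 : ℝ) ^ (1 - 2 * a) = 2 / (2 ^ a) ^ 2 := by
    rw [rpow_sub two_pos, rpow_one, mul_comm 2 a, rpow_mul two_pos.le, rpow_two]
  have hpow' : (1 / (2 * r)) ^ (2 * a) = 1 / ((2 ^ a) ^ 2 * (r ^ a) ^ 2) := by
    rw [mul_comm 2 a, rpow_mul (by positivity), rpow_two, div_rpow zero_le_one (by positivity),
      one_rpow, mul_rpow two_pos.le hr.le]
    ring
  have h2a : 0 < (2 : ℝ) ^ a := rpow_pos_of_pos two_pos a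
  have hra : 0 < r ^ a := rpow_pos_of_pos hr a
  have hpi : 0 < √π := sqrt_pos.mpr pi_pos
  rw [hpow] at hdup
  rw [hpow', Gamma_one_half_eq, add_comm (1 / 2) a]
  field_simp at hdup ⊢
  linarith

/-- Utility theorem (mean part): the total noise `∑_{i=1}^N (G₁ᵢ - G₂ᵢ)`, with all `2N`
variables i.i.d. gamma of shape `1/(N-M)` and scale `λ` (rate `1/λ`), satisfies
`E|noise| = 2λ / B(1/2, 1/(1-α))` with `α = M/N`; consequently, for the perturbed aggregate,
the mean absolute percentage error satisfies
`μ(t) = E|X_t - X̂_t| / (X_t + 1) ≤ (2 / B(1/2, 1/(1-α))) · λ/(X_t + 1)`. -/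
theorem utility_mean (N M : ℕ) (hM : M < N) (lam : ℝ) (hlam : 0 < lam) :
    (∫ p : (Fin N → ℝ) × (Fin N → ℝ), |∑ i, (p.1 i - p.2 i)|
        ∂((Measure.pi fun _ : Fin N => gammaMeasure (1 / ((N : ℝ) - M)) (1 / lam)).prod
            (Measure.pi fun _ : Fin N => gammaMeasure (1 / ((N : ℝ) - M)) (1 / lam)))
      = 2 * lam /
          (Real.Gamma (1 / 2) * Real.Gamma (1 / (1 - (M : ℝ) / N)) /
            Real.Gamma (1 / 2 + 1 / (1 - (M : ℝ) / N)))) ∧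
    ∀ Xt : ℝ, 0 ≤ Xt →
      (∫ p : (Fin N → ℝ) × (Fin N → ℝ), |∑ i, (p.1 i - p.2 i)|
          ∂((Measure.pi fun _ : Fin N => gammaMeasure (1 / ((N : ℝ) - M)) (1 / lam)).prod
              (Measure.pi fun _ : Fin N => gammaMeasure (1 / ((N : ℝ) - M)) (1 / lam))))
          / (Xt + 1)
        ≤ (2 / (Real.Gamma (1 / 2) * Real.Gamma (1 / (1 - (M : ℝ) / N)) /
              Real.Gamma (1 / 2 + 1 / (1 - (M : ℝ) / N)))) * (lam / (Xt + 1)) := by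
  have hN : (0 : ℝ) < N := by exact_mod_cast (Nat.zero_le M).trans_lt hM
  have hNM : (0 : ℝ) < (N : ℝ) - M := sub_pos.mpr (by exact_mod_cast hM)
  have : Nonempty (Fin N) := ⟨⟨M, hM⟩⟩
  have ha : 0 < 1 / ((N : ℝ) - M) := by positivity
  have hr : 0 < 1 / lam := by positivity
  have hk : (Fintype.card (Fin N) : ℝ) * (1 / ((N : ℝ) - M)) = 1 / (1 - (M : ℝ) / N) := by
    rw [Fintype.card_fin]
    field_simp
  have hk0 : 0 < 1 / (1 - (M : ℝ) / N) := by
    rw [← hk, Fintype.card_fin]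
    positivity
  have := isProbabilityMeasure_gammaMeasure ha hr
  have hm : Measurable fun x : Fin N → ℝ => ∑ i, x i := by fun_prop
  have hsum := map_sum_pi_gammaMeasure (ι := Fin N) ha hr
  rw [hk] at hsum
  have key := integral_abs_sub_prod_gammaMeasure hk0 hr
  rw [← hsum, Measure.map_prod_map _ _ hm hm,
    integral_map (hm.prodMap hm).aemeasurable (by fun_prop), div_div_eq_mul_div 2 1 lam,
    div_one] at key
  simp only [Prod.map_fst, Prod.map_snd, ← Finset.sum_sub_distrib] at key
  refine ⟨key, fun Xt _ => le_of_eq ?_⟩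
  rw [key]
  ring
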